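/- arXiv:math/0512509 — 5 statements merged into one kernel-verified Lean document; each statement's English description precedes it below -/
import Mathlib

section
/- Let n ≥ 1, let t > 0 and let f : (Fin n → ℝ) → ℝ≥0∞ be measurable. Then the Lebesgue integral of f over the open simplex Δₙ(t) = {s : Fin n → ℝ | 0 < s 0 ∧ (∀ i j, i < j → s i < s j) ∧ s (n−1) < t} (with respect to n-dimensional Lebesgue measure) equals ∫₀ᵗ ( ∫_{Δ_{n−1}(u)} f (Fin.snoc s u) ds ) du, i.e. the integral obtained by first integrating over the simplex of the first n−1 coordinates below the last coordinate u and then integrating u over (0, t). -/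
open MeasureTheory ENNReal

/-- The open simplex `Δₙ(t) = {s | 0 < s 0 < s 1 < ⋯ < s (n-1) < t}` in `Fin n → ℝ`
(for `n = 0` the conditions are vacuous). -/
def openSimplex (n : ℕ) (t : ℝ) : Set (Fin n → ℝ) :=
  {s : Fin n → ℝ | (∀ i j : Fin n, i < j → s i < s j) ∧ ∀ i : Fin n, 0 < s i ∧ s i < t}

theorem measurableSet_openSimplex (n : ℕ) (t : ℝ) : MeasurableSet (openSimplex n t) := by
  have h : openSimplex n t =
      (⋂ i : Fin n, ⋂ j : Fin n, ⋂ _ : i < j, {s | s i < s j}) ∩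
        ⋂ i : Fin n, {s | 0 < s i} ∩ {s | s i < t} := by
    ext s
    simp [openSimplex]
  rw [h]
  exact (MeasurableSet.iInter fun i ↦ MeasurableSet.iInter fun j ↦ MeasurableSet.iInter fun _ ↦
      measurableSet_lt (measurable_pi_apply i) (measurable_pi_apply j)).inter
    (MeasurableSet.iInter fun i ↦ (measurableSet_lt measurable_const (measurable_pi_apply i)).inter
      (measurableSet_lt (measurable_pi_apply i) measurable_const))

theorem snoc_mem_openSimplex_iff {m : ℕ} {t u : ℝ} {s : Fin m → ℝ} :
    (Fin.snoc s u : Fin (m + 1) → ℝ) ∈ openSimplex (m + 1) t ↔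
      u ∈ Set.Ioo 0 t ∧ s ∈ openSimplex m u := by
  simp only [openSimplex, Set.mem_ofPred_eq, Fin.forall_fin_succ', Fin.snoc_castSucc,
    Fin.snoc_last, Fin.castSucc_lt_castSucc_iff, Fin.castSucc_lt_last, lt_irrefl,
    Fin.not_lt.mpr (Fin.le_last _), Set.mem_Ioo, forall_true_left, false_implies, implies_true,
    and_true]
  constructor
  · rintro ⟨hs, hpos, hu⟩
    exact ⟨hu, fun i ↦ (hs i).1, fun i ↦ ⟨(hpos i).1, (hs i).2⟩⟩
  · rintro ⟨hu, hs, hpos⟩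
    exact ⟨fun i ↦ ⟨hs i, (hpos i).2⟩, fun i ↦ ⟨(hpos i).1, (hpos i).2.trans hu.2⟩, hu⟩

/-- Tonelli's theorem on `Fin (m + 1) → ℝ`, with the last coordinate integrated last. -/
theorem lintegral_pi_eq_lintegral_lintegral_snoc {m : ℕ} {μ : Measure ℝ} [SigmaFinite μ]
    {g : (Fin (m + 1) → ℝ) → ℝ≥0∞} (hg : Measurable g) :
    ∫⁻ s, g s ∂(Measure.pi fun _ : Fin (m + 1) => μ) =
      ∫⁻ u, ∫⁻ s, g (Fin.snoc s u) ∂(Measure.pi fun _ : Fin m => μ) ∂μ := by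
  have e := (measurePreserving_piFinSuccAbove (fun _ : Fin (m + 1) => μ) (Fin.last m)).symm
  rw [← e.lintegral_comp hg, lintegral_prod _ (by exact (hg.comp e.measurable).aemeasurable)]
  simp [MeasurableEquiv.piFinSuccAbove_symm_apply, Fin.snocEquiv]

/-- Last point extraction: the integral over `Δ_{n}(t)` (`n ≥ 1`, written `n = m + 1`)
is obtained by integrating over the simplex of the first `n - 1` coordinates below the
last coordinate `u` and then integrating `u` over `(0, t)`. -/
theorem simplex_lintegral_snoc (m : ℕ) (t : ℝ) (ht : 0 < t)
    (f : (Fin (m + 1) → ℝ) → ℝ≥0∞) (hf : Measurable f) :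
    ∫⁻ s in openSimplex (m + 1) t, f s
        ∂(Measure.pi fun _ : Fin (m + 1) => (volume : Measure ℝ))
      = ∫⁻ u in Set.Ioo (0 : ℝ) t,
          (∫⁻ s in openSimplex m u, f (Fin.snoc s u)
            ∂(Measure.pi fun _ : Fin m => (volume : Measure ℝ))) ∂volume := by
  classical
  have hS := measurableSet_openSimplex (m + 1) t
  rw [← lintegral_indicator hS, lintegral_pi_eq_lintegral_lintegral_snoc (hf.indicator hS),
    ← lintegral_indicator measurableSet_Ioo]
  refine lintegral_congr fun u ↦ ?_
  by_cases hu : u ∈ Set.Ioo 0 t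
  · rw [Set.indicator_of_mem hu, ← lintegral_indicator (measurableSet_openSimplex m u)]
    refine lintegral_congr fun s ↦ ?_
    simp only [Set.indicator_apply, snoc_mem_openSimplex_iff, hu, true_and]
  · simp [snoc_mem_openSimplex_iff, hu, -Set.mem_Ioo]
end

section
/- Let (X, μ) be a σ-finite measure space and for each n ∈ ℕ let g_n, h_n : (Fin n → X) → ℝ≥0∞ be measurable. For k ∈ ℕ, x : Fin k → X and S a subset (Finset) of Fin k, let x|S : Fin S.card → X denote x composed with the monotone enumeration of S. Then ∑_{k=0}^∞ (1/k!) ∫_{X^k} ( ∑_{S ⊆ Fin k} g_{S.card}(x|S) · h_{k − S.card}(x|Sᶜ) ) d(μᵏ)(x) = ( ∑_{n=0}^∞ (1/n!) ∫_{Xⁿ} g_n d(μⁿ) ) · ( ∑_{m=0}^∞ (1/m!) ∫_{Xᵐ} h_m d(μᵐ) ), with all sums and integrals in ℝ≥0∞. -/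
open MeasureTheory ENNReal

/-- `x` restricted to a finite subset `S` of indices, via the monotone enumeration of `S`. -/
def finsetRestrict {X : Type*} {k : ℕ} (x : Fin k → X) (S : Finset (Fin k))
    {m : ℕ} (h : S.card = m) : Fin m → X :=
  fun i => x ((S.orderIsoOfFin h i : Fin k))

/-- For `S ⊆ Fin k`, splitting `x` into its restrictions to `S` and `Sᶜ` carries the `k`-fold
product measure to the product of the `m`-fold and `n`-fold ones. -/
theorem measurePreserving_finsetRestrict {X : Type*} [MeasurableSpace X]
    (μ : Measure X) [SigmaFinite μ] {k m n : ℕ} (S : Finset (Fin k))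
    (hm : S.card = m) (hn : Sᶜ.card = n) :
    MeasurePreserving (fun x : Fin k → X => (finsetRestrict x S hm, finsetRestrict x Sᶜ hn))
      (Measure.pi fun _ => μ)
      ((Measure.pi fun _ : Fin m => μ).prod (Measure.pi fun _ : Fin n => μ)) :=
  (measurePreserving_sumPiEquivProdPi fun _ : Fin m ⊕ Fin n => μ).comp
    ((measurePreserving_piCongrLeft (fun _ : Fin k => μ) (finSumEquivOfFinset hm hn)).symm)

theorem lintegral_finsetRestrict_mul {X : Type*} [MeasurableSpace X]
    (μ : Measure X) [SigmaFinite μ] {k m n : ℕ} (S : Finset (Fin k))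
    (hm : S.card = m) (hn : Sᶜ.card = n) {f : (Fin m → X) → ℝ≥0∞} {g : (Fin n → X) → ℝ≥0∞}
    (hf : Measurable f) (hg : Measurable g) :
    ∫⁻ x : Fin k → X, f (finsetRestrict x S hm) * g (finsetRestrict x Sᶜ hn)
        ∂(Measure.pi fun _ => μ) =
      (∫⁻ x, f x ∂(Measure.pi fun _ => μ)) * ∫⁻ x, g x ∂(Measure.pi fun _ => μ) := by
  rw [← lintegral_prod_mul hf.aemeasurable hg.aemeasurable,
    ← (measurePreserving_finsetRestrict μ S hm hn).lintegral_comp (by fun_prop)]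

theorem measurable_finsetRestrict {X : Type*} [MeasurableSpace X] {k m : ℕ}
    (S : Finset (Fin k)) (hm : S.card = m) :
    Measurable fun x : Fin k → X => finsetRestrict x S hm :=
  measurable_pi_lambda _ fun _ => measurable_pi_apply _

theorem ENNReal.tsum_mul_tsum_eq_tsum_sum_range (a b : ℕ → ℝ≥0∞) :
    (∑' n, a n) * ∑' m, b m = ∑' k, ∑ n ∈ Finset.range (k + 1), a n * b (k - n) := by
  simp_rw [← ENNReal.tsum_mul_right, ← ENNReal.tsum_mul_left,
    ← Finset.Nat.sum_antidiagonal_eq_sum_range_succ fun n m => a n * b m]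
  rw [← ENNReal.tsum_prod, ← Finset.HasAntidiagonal.sigmaAntidiagonalEquivProd.tsum_eq,
    ENNReal.tsum_sigma']
  exact tsum_congr fun k =>
    (Finset.HasAntidiagonal.antidiagonal k).tsum_subtype fun p => a p.1 * b p.2

theorem ENNReal.one_div_factorial_mul_choose {k n : ℕ} (h : n ≤ k) :
    1 / (k.factorial : ℝ≥0∞) * k.choose n =
      1 / (n.factorial : ℝ≥0∞) * (1 / ((k - n).factorial : ℝ≥0∞)) := by
  have h0 (j : ℕ) : (j.factorial : ℝ≥0∞) ≠ 0 := by exact_mod_cast j.factorial_ne_zero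
  have ht (j : ℕ) : (j.factorial : ℝ≥0∞) ≠ ∞ := ENNReal.natCast_ne_top _
  rw [one_div, one_div, one_div, ← ENNReal.mul_inv (.inl (h0 n)) (.inl (ht n)), mul_comm,
    ← div_eq_mul_inv, ← one_div,
    ENNReal.div_eq_div_iff (mul_ne_zero (h0 n) (h0 _)) (ENNReal.mul_ne_top (ht n) (ht _))
      (h0 k) (ht k)]
  norm_cast
  rw [mul_one, mul_comm, ← mul_assoc, Nat.choose_mul_factorial_mul_factorial h]

/-- The sum-point integral property of the symmetric (Guichardet) measure, levelwise:
`∑ₖ (1/k!) ∫_{Xᵏ} ∑_{S ⊆ Fin k} g(x|S) h(x|Sᶜ) = (∑ₙ (1/n!) ∫ gₙ)(∑ₘ (1/m!) ∫ hₘ)`. -/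
theorem tsum_pi_lintegral_sum_subsets {X : Type*} [MeasurableSpace X]
    (μ : Measure X) [SigmaFinite μ]
    (g h : (n : ℕ) → (Fin n → X) → ℝ≥0∞)
    (hg : ∀ n, Measurable (g n)) (hh : ∀ n, Measurable (h n)) :
    ∑' k : ℕ, (1 / (Nat.factorial k : ℝ≥0∞)) *
        ∫⁻ x : Fin k → X,
          (∑ S : Finset (Fin k),
            g S.card (finsetRestrict x S rfl) *
              h (k - S.card)
                (finsetRestrict x Sᶜ (by rw [Finset.card_compl, Fintype.card_fin])))
          ∂(Measure.pi fun _ : Fin k => μ)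
      = (∑' n : ℕ, (1 / (Nat.factorial n : ℝ≥0∞)) *
            ∫⁻ x : Fin n → X, g n x ∂(Measure.pi fun _ : Fin n => μ)) *
        (∑' m : ℕ, (1 / (Nat.factorial m : ℝ≥0∞)) *
            ∫⁻ x : Fin m → X, h m x ∂(Measure.pi fun _ : Fin m => μ)) := by
  rw [ENNReal.tsum_mul_tsum_eq_tsum_sum_range]
  refine tsum_congr fun k => ?_
  have hcard (S : Finset (Fin k)) : Sᶜ.card = k - S.card := by
    rw [Finset.card_compl, Fintype.card_fin]
  have hmeas (S : Finset (Fin k)) : Measurable fun x : Fin k → X =>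
      g S.card (finsetRestrict x S rfl) * h (k - S.card) (finsetRestrict x Sᶜ (hcard S)) :=
    ((hg _).comp (measurable_finsetRestrict S rfl)).mul
      ((hh _).comp (measurable_finsetRestrict Sᶜ (hcard S)))
  rw [lintegral_finsetSum _ fun S _ => hmeas S]
  simp_rw [fun S : Finset (Fin k) =>
    lintegral_finsetRestrict_mul μ S rfl (hcard S) (hg _) (hh _)]
  rw [← Finset.powerset_univ, Finset.sum_powerset_apply_card fun n =>
      (∫⁻ x, g n x ∂(Measure.pi fun _ => μ)) * ∫⁻ x, h (k - n) x ∂(Measure.pi fun _ => μ),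
    Finset.card_univ, Fintype.card_fin, Finset.mul_sum]
  refine Finset.sum_congr rfl fun n hn => ?_
  rw [nsmul_eq_mul, ← mul_assoc,
    ENNReal.one_div_factorial_mul_choose (Finset.mem_range_succ_iff.mp hn), mul_mul_mul_comm]
end

section
/- Let (X, μ) be a σ-finite measure space and for each m ∈ ℕ let F_m : X × (Fin m → X) → ℝ≥0∞ be measurable. Then ∑_{n=0}^∞ (1/(n+1)!) ∫_{X^{n+1}} ( ∑_{i : Fin (n+1)} F_n (x i, x ∘ i.succAbove) ) d(μ^{n+1})(x) = ∫_X ( ∑_{m=0}^∞ (1/m!) ∫_{Xᵐ} F_m (y, ·) d(μᵐ) ) dμ(y), with all sums and integrals taken in ℝ≥0∞, where x ∘ i.succAbove : Fin n → X is the tuple x with its i-th coordinate removed. -/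
open MeasureTheory ENNReal

/-- Splitting off the `i`-th coordinate of a product of copies of `μ` in a Lebesgue integral. -/
theorem lintegral_pi_comp_succAbove {X : Type*} [MeasurableSpace X]
    (μ : Measure X) [SigmaFinite μ] {n : ℕ} {f : X × (Fin n → X) → ℝ≥0∞} (hf : Measurable f)
    (i : Fin (n + 1)) :
    ∫⁻ x : Fin (n + 1) → X, f (x i, x ∘ i.succAbove) ∂(Measure.pi fun _ : Fin (n + 1) => μ)
      = ∫⁻ y, ∫⁻ z : Fin n → X, f (y, z) ∂(Measure.pi fun _ : Fin n => μ) ∂μ := by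
  rw [← lintegral_prod f hf.aemeasurable]
  exact (measurePreserving_piFinSuccAbove (fun _ => μ) i).lintegral_comp hf

/-- Single-point extraction identity for the symmetric (Guichardet) measure, levelwise:
`∑ₙ (1/(n+1)!) ∫_{X^{n+1}} ∑ᵢ Fₙ(xᵢ, x with i-th entry removed)
  = ∫_X ∑ₘ (1/m!) ∫_{Xᵐ} Fₘ(y, ·) dμ(y)`. -/
theorem tsum_pi_lintegral_point_extraction {X : Type*} [MeasurableSpace X]
    (μ : Measure X) [SigmaFinite μ]
    (F : (m : ℕ) → X × (Fin m → X) → ℝ≥0∞) (hF : ∀ m, Measurable (F m)) :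
    ∑' n : ℕ, (1 / (Nat.factorial (n + 1) : ℝ≥0∞)) *
        ∫⁻ x : Fin (n + 1) → X,
          (∑ i : Fin (n + 1), F n (x i, x ∘ i.succAbove))
          ∂(Measure.pi fun _ : Fin (n + 1) => μ)
      = ∫⁻ y, (∑' m : ℕ, (1 / (Nat.factorial m : ℝ≥0∞)) *
          ∫⁻ z : Fin m → X, F m (y, z) ∂(Measure.pi fun _ : Fin m => μ)) ∂μ := by
  have hmeas (m : ℕ) :
      Measurable fun y => ∫⁻ z : Fin m → X, F m (y, z) ∂(Measure.pi fun _ : Fin m => μ) :=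
    (hF m).lintegral_prod_right'
  rw [lintegral_tsum fun m => ((hmeas m).const_mul _).aemeasurable]
  refine tsum_congr fun n => ?_
  have hcoord (i : Fin (n + 1)) :
      Measurable fun x : Fin (n + 1) → X => F n (x i, x ∘ i.succAbove) :=
    (hF n).comp ((measurable_pi_apply i).prodMk
      (measurable_pi_iff.2 fun j => measurable_pi_apply (i.succAbove j)))
  have hfact : 1 / (Nat.factorial (n + 1) : ℝ≥0∞) * ((n + 1 : ℕ) : ℝ≥0∞)
      = 1 / (Nat.factorial n : ℝ≥0∞) := by
    have h0 : ((n + 1 : ℕ) : ℝ≥0∞) ≠ 0 := Nat.cast_ne_zero.2 n.succ_ne_zero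
    have htop : ((n + 1 : ℕ) : ℝ≥0∞) ≠ ∞ := natCast_ne_top _
    rw [Nat.factorial_succ, Nat.cast_mul, one_div, one_div,
      ENNReal.mul_inv (Or.inl h0) (Or.inl htop), mul_right_comm,
      ENNReal.inv_mul_cancel h0 htop, one_mul]
  rw [lintegral_finsetSum _ fun i _ => hcoord i, lintegral_const_mul _ (hmeas n)]
  simp only [lintegral_pi_comp_succAbove μ (hF n), Finset.sum_const, Finset.card_univ,
    Fintype.card_fin, nsmul_eq_mul]
  rw [← mul_assoc, hfact]
end

section
/- Let X be a type with decidable equality and A a unital C*-algebra. A table is a quadruple ϰ = (ϰ₀⁻, ϰ₀⁰, ϰ₊⁰, ϰ₊⁻) of finite subsets (Finsets) of X, and a kernel is a function T from quadruples of Finsets of X to A. Define the involution T⋆(ϰ₀⁻, ϰ₀⁰, ϰ₊⁰, ϰ₊⁻) = (T(ϰ₊⁰, ϰ₀⁰, ϰ₀⁻, ϰ₊⁻))* and the product (S·T)(ϰ₀⁻, ϰ₀⁰, ϰ₊⁰, ϰ₊⁻) = ∑ S(ϑ₀⁻ ∪ ϑ₊⁻, ϰ₀⁰ ∪ ϑ₊⁰,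 ϰ₊⁰ \ ϑ₊⁰, ϰ₊⁻ \ σ) * T(ϰ₀⁻ \ ϑ₀⁻, ϰ₀⁰ ∪ ϑ₀⁻, ϑ₊⁻ ∪ ϑ₊⁰, ϰ₊⁻ \ ρ), the sum ranging over all Finsets ϑ₀⁻ ⊆ ϰ₀⁻, ϑ₊⁰ ⊆ ϰ₊⁰ and all ordered pairs (σ, ρ) of Finsets with σ ∪ ρ = ϰ₊⁻, where ϑ₊⁻ = σ ∩ ρ. Then for all kernels S, T and every table ϰ whose four components are pairwise disjoint, ((S·T)⋆)(ϰ) = (T⋆ · S⋆)(ϰ). -/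
variable {X : Type*} [DecidableEq X]

/-- The involution `T⋆(ϰ₀⁻, ϰ₀⁰, ϰ₊⁰, ϰ₊⁻) = (T(ϰ₊⁰, ϰ₀⁰, ϰ₀⁻, ϰ₊⁻))*` on kernels. -/
def kernelStar {A : Type*} [Star A]
    (T : Finset X → Finset X → Finset X → Finset X → A) :
    Finset X → Finset X → Finset X → Finset X → A :=
  fun k0m k00 kp0 kpm => star (T kp0 k00 k0m kpm)

/-- The kernel product (formula (2.5)):
`(S·T)(ϰ₀⁻, ϰ₀⁰, ϰ₊⁰, ϰ₊⁻) = ∑ S(ϑ₀⁻ ∪ ϑ₊⁻, ϰ₀⁰ ∪ ϑ₊⁰, ϰ₊⁰ \ ϑ₊⁰, ϰ₊⁻ \ σ) *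
T(ϰ₀⁻ \ ϑ₀⁻, ϰ₀⁰ ∪ ϑ₀⁻, ϑ₊⁻ ∪ ϑ₊⁰, ϰ₊⁻ \ ρ)`, summed over `ϑ₀⁻ ⊆ ϰ₀⁻`,
`ϑ₊⁰ ⊆ ϰ₊⁰` and pairs `(σ, ρ)` with `σ ∪ ρ = ϰ₊⁻`, where `ϑ₊⁻ = σ ∩ ρ`. -/
def kernelMul {A : Type*} [NonUnitalNonAssocSemiring A]
    (S T : Finset X → Finset X → Finset X → Finset X → A) :
    Finset X → Finset X → Finset X → Finset X → A :=
  fun k0m k00 kp0 kpm =>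
    ∑ t0m ∈ k0m.powerset, ∑ tp0 ∈ kp0.powerset,
      ∑ p ∈ (kpm.powerset ×ˢ kpm.powerset).filter (fun p => p.1 ∪ p.2 = kpm),
        S (t0m ∪ (p.1 ∩ p.2)) (k00 ∪ tp0) (kp0 \ tp0) (kpm \ p.1) *
          T (k0m \ t0m) (k00 ∪ t0m) ((p.1 ∩ p.2) ∪ tp0) (kpm \ p.2)

/-- Anti-multiplicativity of the kernel involution on tables with pairwise
disjoint components: `(S·T)⋆ = T⋆ · S⋆`. -/
theorem kernelStar_kernelMul {A : Type*} [NormedRing A] [StarRing A] [CStarRing A]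
    [NormedAlgebra ℂ A] [CompleteSpace A] [StarModule ℂ A]
    (S T : Finset X → Finset X → Finset X → Finset X → A)
    (k0m k00 kp0 kpm : Finset X)
    (h₁ : Disjoint k0m k00) (h₂ : Disjoint k0m kp0) (h₃ : Disjoint k0m kpm)
    (h₄ : Disjoint k00 kp0) (h₅ : Disjoint k00 kpm) (h₆ : Disjoint kp0 kpm) :
    kernelStar (kernelMul S T) k0m k00 kp0 kpm
      = kernelMul (kernelStar T) (kernelStar S) k0m k00 kp0 kpm := by
  simp only [kernelStar, kernelMul, star_sum, star_mul]
  rw [Finset.sum_comm]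
  refine Finset.sum_congr rfl fun a _ => Finset.sum_congr rfl fun b _ => ?_
  refine Finset.sum_nbij' Prod.swap Prod.swap ?_ ?_ (fun _ _ => rfl) (fun _ _ => rfl) ?_
  · simp +contextual [Finset.union_comm]
  · simp +contextual [Finset.union_comm]
  · rintro ⟨σ, ρ⟩ _
    simp only [Prod.swap, Finset.inter_comm ρ σ, Finset.union_comm a, Finset.union_comm b]
end

section
/- Let X be a type with decidable equality and A a unital C*-algebra; let kernels, the involution T⋆ and the product S·T of kernels T : (Finset X)⁴ → A be as in formula (2.5): T⋆(ϰ₀⁻, ϰ₀⁰, ϰ₊⁰, ϰ₊⁻) = (T(ϰ₊⁰, ϰ₀⁰, ϰ₀⁻, ϰ₊⁻))* and (S·T)(ϰ₀⁻, ϰ₀⁰, ϰ₊⁰, ϰ₊⁻) = ∑ S(ϑ₀⁻ ∪ ϑ₊⁻, ϰ₀⁰ ∪ ϑ₊⁰, ϰ₊⁰ \ ϑ₊⁰, ϰ₊⁻ \ σ) * T(ϰ₀⁻ \ ϑ₀⁻, ϰ₀⁰ ∪ ϑ₀⁻, ϑ₊⁻ ∪ ϑ₊⁰, ϰ₊⁻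 \ ρ), summed over ϑ₀⁻ ⊆ ϰ₀⁻, ϑ₊⁰ ⊆ ϰ₊⁰ and pairs (σ, ρ) with σ ∪ ρ = ϰ₊⁻ and ϑ₊⁻ = σ ∩ ρ. Given weight functions ζ₀⁻, ζ₀⁰, ζ₊⁰, ζ₊⁻ : X → ℝ≥0, define the relative norm ‖T‖(ζ) ∈ ℝ≥0∞ as the supremum, over all tables ϰ with pairwise disjoint components, of ‖T(ϰ)‖ divided by (∏_{x∈ϰ₀⁻} ζ₀⁻ x)(∏_{x∈ϰ₀⁰} ζ₀⁰ x)(∏_{x∈ϰ₊⁰} ζ₊⁰ x)(∏_{x∈ϰ₊⁻} ζ₊⁻ x). Define ζ⋆ by exchanging ζ₀⁻ and ζ₊⁰ (leaving ζ₀⁰, ζ₊⁻ fixed), and ζ⋆ζ by (ζ⋆ζ)₀⁰ = ζ₀⁰², (ζ⋆ζ)₀⁻ = ζ₀⁻ + ζ₀⁰ ζ₊⁰ = (ζ⋆ζ)₊⁰, and (ζ⋆ζ)₊⁻ = 2 ζ₊⁻ + ζ₊⁰² (pointwise on X). Then ‖T⋆‖(ζ⋆) = ‖T‖(ζ) and ‖T⋆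 · T‖(ζ⋆ζ) ≤ (‖T‖(ζ))². -/
open scoped ENNReal NNReal

variable {X : Type*} [DecidableEq X]

/-- The relative norm `‖T‖(ζ)`: the supremum over all tables with pairwise disjoint
components of `‖T(ϰ)‖` divided by the product of the weights `ζ` over the entries. -/
noncomputable def kernelNorm {A : Type*} [NormedRing A]
    (T : Finset X → Finset X → Finset X → Finset X → A)
    (z0m z00 zp0 zpm : X → ℝ≥0) : ℝ≥0∞ :=
  ⨆ (k0m : Finset X) (k00 : Finset X) (kp0 : Finset X) (kpm : Finset X)
    (_ : Disjoint k0m k00) (_ : Disjoint k0m kp0) (_ : Disjoint k0m kpm)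
    (_ : Disjoint k00 kp0) (_ : Disjoint k00 kpm) (_ : Disjoint kp0 kpm),
    (‖T k0m k00 kp0 kpm‖₊ : ℝ≥0∞) /
      (((∏ x ∈ k0m, z0m x) * (∏ x ∈ k00, z00 x) *
        (∏ x ∈ kp0, zp0 x) * (∏ x ∈ kpm, zpm x) : ℝ≥0) : ℝ≥0∞)

/-- The expansion of `∏ (a + b + c)` as a sum over pairs covering the index set. -/
theorem sum_cover_pairs_prod {R : Type*} [CommSemiring R] (s : Finset X) (a b c : X → R) :
    ∑ p ∈ (s.powerset ×ˢ s.powerset).filter (fun p => p.1 ∪ p.2 = s),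
      (∏ x ∈ p.1 ∩ p.2, c x) * (∏ x ∈ s \ p.1, a x) * (∏ x ∈ s \ p.2, b x) =
    ∏ x ∈ s, (a x + b x + c x) := by
  have expand : ∏ x ∈ s, (a x + b x + c x) =
      ∑ q ∈ s.powerset.sigma (fun t => t.powerset),
        (∏ x ∈ q.2, c x) * (∏ x ∈ q.1 \ q.2, b x) * (∏ x ∈ s \ q.1, a x) := by
    rw [Finset.sum_sigma, Finset.prod_congr rfl
      (fun x _ => (by ring : a x + b x + c x = (c x + b x) + a x)), Finset.prod_add]
    refine Finset.sum_congr rfl fun t _ => ?_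
    rw [Finset.prod_add, Finset.sum_mul]
  rw [expand]
  refine Finset.sum_bij' (fun p _ => ⟨p.1, p.1 ∩ p.2⟩) (fun q _ => (q.1, (s \ q.1) ∪ q.2))
    ?_ ?_ ?_ ?_ ?_
  · rintro ⟨σ, ρ⟩ h
    simp only [Finset.mem_filter, Finset.mem_product, Finset.mem_powerset] at h
    simp only [Finset.mem_sigma, Finset.mem_powerset]
    exact ⟨h.1.1, Finset.inter_subset_left⟩
  · rintro ⟨t, u⟩ h
    simp only [Finset.mem_sigma, Finset.mem_powerset] at h
    simp only [Finset.mem_filter, Finset.mem_product, Finset.mem_powerset]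
    grind
  · rintro ⟨σ, ρ⟩ h
    simp only [Finset.mem_filter, Finset.mem_product, Finset.mem_powerset] at h
    ext x <;> grind
  · rintro ⟨t, u⟩ h
    simp only [Finset.mem_sigma, Finset.mem_powerset] at h
    have : t ∩ (s \ t ∪ u) = u := by grind
    simp [this]
  · rintro ⟨σ, ρ⟩ h
    simp only [Finset.mem_filter, Finset.mem_product, Finset.mem_powerset] at h
    have : s \ ρ = σ \ (σ ∩ ρ) := by grind
    simp only [this]
    ring

theorem kernelStar_kernelStar {X A : Type*} [InvolutiveStar A]
    (T : Finset X → Finset X → Finset X → Finset X → A) :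
    kernelStar (kernelStar T) = T := by
  funext k0m k00 kp0 kpm
  simp [kernelStar]

theorem le_kernelNorm {X A : Type*} [NormedRing A]
    (T : Finset X → Finset X → Finset X → Finset X → A) (z0m z00 zp0 zpm : X → ℝ≥0)
    {k0m k00 kp0 kpm : Finset X} (h₁ : Disjoint k0m k00) (h₂ : Disjoint k0m kp0)
    (h₃ : Disjoint k0m kpm) (h₄ : Disjoint k00 kp0) (h₅ : Disjoint k00 kpm)
    (h₆ : Disjoint kp0 kpm) :
    (‖T k0m k00 kp0 kpm‖₊ : ℝ≥0∞) /
      (((∏ x ∈ k0m, z0m x) * (∏ x ∈ k00, z00 x) *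
        (∏ x ∈ kp0, zp0 x) * (∏ x ∈ kpm, zpm x) : ℝ≥0) : ℝ≥0∞) ≤
      kernelNorm T z0m z00 zp0 zpm :=
  le_iSup_of_le k0m <| le_iSup_of_le k00 <| le_iSup_of_le kp0 <| le_iSup_of_le kpm <|
    le_iSup_of_le h₁ <| le_iSup_of_le h₂ <| le_iSup_of_le h₃ <| le_iSup_of_le h₄ <|
    le_iSup_of_le h₅ <| le_iSup_of_le h₆ le_rfl

theorem nnnorm_le_of_kernelNorm_le {X A : Type*} [NormedRing A]
    {T : Finset X → Finset X → Finset X → Finset X → A} {z0m z00 zp0 zpm : X → ℝ≥0}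
    {n : ℝ≥0} (hn : kernelNorm T z0m z00 zp0 zpm ≤ n)
    {k0m k00 kp0 kpm : Finset X} (h₁ : Disjoint k0m k00) (h₂ : Disjoint k0m kp0)
    (h₃ : Disjoint k0m kpm) (h₄ : Disjoint k00 kp0) (h₅ : Disjoint k00 kpm)
    (h₆ : Disjoint kp0 kpm) :
    ‖T k0m k00 kp0 kpm‖₊ ≤ n * ((∏ x ∈ k0m, z0m x) * (∏ x ∈ k00, z00 x) *
      (∏ x ∈ kp0, zp0 x) * (∏ x ∈ kpm, zpm x)) := by
  have h := (le_kernelNorm T z0m z00 zp0 zpm h₁ h₂ h₃ h₄ h₅ h₆).trans hn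
  rw [ENNReal.div_le_iff_le_mul (.inr ENNReal.coe_ne_top) (.inl ENNReal.coe_ne_top)] at h
  exact_mod_cast h

theorem kernelNorm_kernelStar_le {X A : Type*} [NormedRing A] [StarRing A] [NormedStarGroup A]
    (T : Finset X → Finset X → Finset X → Finset X → A) (z0m z00 zp0 zpm : X → ℝ≥0) :
    kernelNorm (kernelStar T) zp0 z00 z0m zpm ≤ kernelNorm T z0m z00 zp0 zpm := by
  refine iSup_le fun k0m => iSup_le fun k00 => iSup_le fun kp0 => iSup_le fun kpm =>
    iSup_le fun h₁ => iSup_le fun h₂ => iSup_le fun h₃ => iSup_le fun h₄ =>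
    iSup_le fun h₅ => iSup_le fun h₆ => ?_
  refine le_of_eq_of_le ?_ (le_kernelNorm T z0m z00 zp0 zpm h₄.symm h₂.symm h₆ h₁.symm h₅ h₃)
  simp only [kernelStar, nnnorm_star]
  congr 2
  ring

theorem kernelNorm_kernelStar {X A : Type*} [NormedRing A] [StarRing A] [NormedStarGroup A]
    (T : Finset X → Finset X → Finset X → Finset X → A) (z0m z00 zp0 zpm : X → ℝ≥0) :
    kernelNorm (kernelStar T) zp0 z00 z0m zpm = kernelNorm T z0m z00 zp0 zpm := by
  refine le_antisymm (kernelNorm_kernelStar_le T z0m z00 zp0 zpm) ?_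
  simpa only [kernelStar_kernelStar] using
    kernelNorm_kernelStar_le (kernelStar T) zp0 z00 z0m zpm

/-- Submultiplicativity of the relative norms with respect to the weights of the two factors. -/
theorem kernelNorm_kernelMul_le {A : Type*} [NormedRing A]
    (S T : Finset X → Finset X → Finset X → Finset X → A)
    {y0m y00 yp0 ypm z0m z00 zp0 zpm : X → ℝ≥0} {m n : ℝ≥0}
    (hm : kernelNorm S y0m y00 yp0 ypm ≤ m) (hn : kernelNorm T z0m z00 zp0 zpm ≤ n) :
    kernelNorm (kernelMul S T) (fun x => y0m x * z00 x + z0m x) (fun x => y00 x * z00 x)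
      (fun x => y00 x * zp0 x + yp0 x) (fun x => ypm x + zpm x + y0m x * zp0 x) ≤
      (m * n : ℝ≥0) := by
  refine iSup_le fun k0m => iSup_le fun k00 => iSup_le fun kp0 => iSup_le fun kpm =>
    iSup_le fun h₁ => iSup_le fun h₂ => iSup_le fun h₃ => iSup_le fun h₄ =>
    iSup_le fun h₅ => iSup_le fun h₆ => ?_
  refine ENNReal.div_le_of_le_mul ?_
  rw [← ENNReal.coe_mul, ENNReal.coe_le_coe, ← sum_cover_pairs_prod, Finset.prod_add,
    Finset.prod_add (fun x => y00 x * zp0 x)]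
  have rearrange : ∀ P Q R W c : ℝ≥0, c * (P * Q * R * W) = P * (R * (W * (c * Q))) := by
    intros; ring
  rw [rearrange, Finset.sum_mul]
  refine (nnnorm_sum_le _ _).trans (Finset.sum_le_sum fun t0m ht0m => ?_)
  rw [Finset.sum_mul, Finset.mul_sum]
  refine (nnnorm_sum_le _ _).trans (Finset.sum_le_sum fun tp0 htp0 => ?_)
  rw [Finset.sum_mul, Finset.mul_sum, Finset.mul_sum]
  refine (nnnorm_sum_le _ _).trans (Finset.sum_le_sum fun p hp => ?_)
  obtain ⟨σ, ρ⟩ := p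
  simp only [Finset.mem_filter, Finset.mem_product, Finset.mem_powerset] at hp ht0m htp0 ⊢
  rw [Finset.disjoint_left] at h₁ h₂ h₃ h₄ h₅ h₆
  have disj_t0m : Disjoint t0m (σ ∩ ρ) := by rw [Finset.disjoint_left]; grind
  have disj_k00_tp0 : Disjoint k00 tp0 := by rw [Finset.disjoint_left]; grind
  have disj_k00_t0m : Disjoint k00 t0m := by rw [Finset.disjoint_left]; grind
  have disj_tp0 : Disjoint (σ ∩ ρ) tp0 := by rw [Finset.disjoint_left]; grind
  have hS := nnnorm_le_of_kernelNorm_le hm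
    (k0m := t0m ∪ (σ ∩ ρ)) (k00 := k00 ∪ tp0) (kp0 := kp0 \ tp0) (kpm := kpm \ σ)
    (by rw [Finset.disjoint_left]; grind) (by rw [Finset.disjoint_left]; grind)
    (by rw [Finset.disjoint_left]; grind) (by rw [Finset.disjoint_left]; grind)
    (by rw [Finset.disjoint_left]; grind) (by rw [Finset.disjoint_left]; grind)
  have hT := nnnorm_le_of_kernelNorm_le hn
    (k0m := k0m \ t0m) (k00 := k00 ∪ t0m) (kp0 := (σ ∩ ρ) ∪ tp0) (kpm := kpm \ ρ)
    (by rw [Finset.disjoint_left]; grind) (by rw [Finset.disjoint_left]; grind)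
    (by rw [Finset.disjoint_left]; grind) (by rw [Finset.disjoint_left]; grind)
    (by rw [Finset.disjoint_left]; grind) (by rw [Finset.disjoint_left]; grind)
  rw [Finset.prod_union disj_t0m, Finset.prod_union disj_k00_tp0] at hS
  rw [Finset.prod_union disj_k00_t0m, Finset.prod_union disj_tp0] at hT
  refine (nnnorm_mul_le _ _).trans ((mul_le_mul' hS hT).trans_eq ?_)
  simp only [Finset.prod_mul_distrib]
  ring

/-- Norm relations of Theorem 2: `‖T⋆‖(ζ⋆) = ‖T‖(ζ)` and
`‖T⋆ · T‖(ζ⋆ζ) ≤ (‖T‖(ζ))²`, where `ζ⋆` exchanges `ζ₀⁻` and `ζ₊⁰` and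
`(ζ⋆ζ)₀⁰ = ζ₀⁰²`, `(ζ⋆ζ)₀⁻ = (ζ⋆ζ)₊⁰ = ζ₀⁻ + ζ₀⁰ζ₊⁰`, `(ζ⋆ζ)₊⁻ = 2ζ₊⁻ + ζ₊⁰²`. -/
theorem kernelNorm_star_and_mul {A : Type*} [NormedRing A] [StarRing A] [CStarRing A]
    [NormedAlgebra ℂ A] [CompleteSpace A] [StarModule ℂ A]
    (T : Finset X → Finset X → Finset X → Finset X → A)
    (z0m z00 zp0 zpm : X → ℝ≥0) :
    kernelNorm (kernelStar T) zp0 z00 z0m zpm = kernelNorm T z0m z00 zp0 zpm ∧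
      kernelNorm (kernelMul (kernelStar T) T)
          (fun x => z0m x + z00 x * zp0 x) (fun x => z00 x ^ 2)
          (fun x => z0m x + z00 x * zp0 x) (fun x => 2 * zpm x + zp0 x ^ 2)
        ≤ (kernelNorm T z0m z00 zp0 zpm) ^ 2 := by
  have hstar := kernelNorm_kernelStar T z0m z00 zp0 zpm
  refine ⟨hstar, ?_⟩
  by_cases htop : kernelNorm T z0m z00 zp0 zpm = ⊤
  · simp [htop]
  obtain ⟨n, hn⟩ : ∃ n : ℝ≥0, (n : ℝ≥0∞) = kernelNorm T z0m z00 zp0 zpm :=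
    ⟨_, ENNReal.coe_toNNReal htop⟩
  have h := kernelNorm_kernelMul_le (kernelStar T) T (hstar.trans hn.symm).le hn.symm.le
  rw [← hn, sq, ← ENNReal.coe_mul]
  convert h using 2 <;> funext x <;> ring
end
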